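/- Let G₁ and G₂ be projectively equivalent sprays on an open set U ⊆ ℝⁿ (n ≥ 2), i.e., G₁ⁱ = G₂ⁱ + P yⁱ for some smooth function P(x,y) positively homogeneous of degree 1 in y, and suppose both have vanishing χ-curvature. Then G₁ is of isotropic curvature if and only if G₂ is of isotropic curvature. -/

import Mathlib

open scoped BigOperators

noncomputable section

/-- Points/vectors in local coordinates on an open subset of `ℝⁿ`. -/
abbrev Vec (n : ℕ) := Fin n → ℝ

variable {n : ℕ}

/-- Partial derivative in the base (`x`) variable, in the `k`-th coordinate direction. -/
noncomputable def pdx (f : Vec n → Vec n → ℝ) (k : Fin n) (x y : Vec n) : ℝ :=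
  fderiv ℝ (fun x' => f x' y) x (Pi.single k 1)

/-- Partial derivative in the fiber (`y`) variable, in the `k`-th coordinate direction;
this is the operation denoted by a subscript `·k`. -/
noncomputable def pdy (f : Vec n → Vec n → ℝ) (k : Fin n) (x y : Vec n) : ℝ :=
  fderiv ℝ (fun y' => f x y') y (Pi.single k 1)

/-- Partial derivative of a function of `x` alone. -/
noncomputable def pd (f : Vec n → ℝ) (k : Fin n) (x : Vec n) : ℝ :=
  fderiv ℝ f x (Pi.single k 1)

/-- `G` is a spray on the open set `U ⊆ ℝⁿ`: the coefficients `Gⁱ(x,y)` are smooth for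
`x ∈ U`, `y ≠ 0`, and positively homogeneous of degree `2` in `y`. -/
def IsSpray (U : Set (Vec n)) (G : Fin n → Vec n → Vec n → ℝ) : Prop :=
  (∀ i, ContDiffOn ℝ (⊤ : ℕ∞) (fun p : Vec n × Vec n => G i p.1 p.2)
      (U ×ˢ {y : Vec n | y ≠ 0})) ∧
  (∀ i (x y : Vec n) (lam : ℝ), 0 < lam → G i x (lam • y) = lam ^ 2 * G i x y)

/-- `N^i_j := ∂G^i/∂y^j`. -/
noncomputable def Nc (G : Fin n → Vec n → Vec n → ℝ) (i j : Fin n) (x y : Vec n) : ℝ :=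
  pdy (G i) j x y

/-- `Γ^i_{jk} := ∂²G^i/∂y^j∂y^k`. -/
noncomputable def Ga (G : Fin n → Vec n → Vec n → ℝ) (i j k : Fin n) (x y : Vec n) : ℝ :=
  pdy (Nc G i j) k x y

/-- The horizontal derivative `δf/δx^k := ∂f/∂x^k − N^m_k ∂f/∂y^m`; for a scalar `f` this is
also the horizontal covariant derivative `f_{|k}`. -/
noncomputable def hd (G : Fin n → Vec n → Vec n → ℝ) (f : Vec n → Vec n → ℝ)
    (k : Fin n) (x y : Vec n) : ℝ :=
  pdx f k x y - ∑ m, Nc G m k x y * pdy f m x y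

/-- The four-index Riemann curvature tensor
`R_j{}^i{}_{kl} := δΓⁱ_{jl}/δx^k − δΓⁱ_{jk}/δx^l + Γⁱ_{ks}Γ^s_{jl} − Γ^s_{jk}Γⁱ_{ls}`. -/
noncomputable def Riem4 (G : Fin n → Vec n → Vec n → ℝ) (j i k l : Fin n)
    (x y : Vec n) : ℝ :=
  hd G (Ga G i j l) k x y - hd G (Ga G i j k) l x y
    + ∑ s, (Ga G i k s x y * Ga G s j l x y - Ga G s j k x y * Ga G i l s x y)

/-- The two-index Riemann curvature `R^i_k := y^j R_j{}^i{}_{kl} y^l`. -/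
noncomputable def Riem2 (G : Fin n → Vec n → Vec n → ℝ) (i k : Fin n)
    (x y : Vec n) : ℝ :=
  ∑ j, ∑ l, y j * Riem4 G j i k l x y * y l

/-- The χ-curvature `χ_k := −(1/6)(2 R^m_{k·m} + R^m_{m·k})`. -/
noncomputable def chi (G : Fin n → Vec n → Vec n → ℝ) (k : Fin n) (x y : Vec n) : ℝ :=
  -(1 / 6) * (2 * ∑ m, pdy (Riem2 G m k) m x y + ∑ m, pdy (Riem2 G m m) k x y)

/-- The scalar `R := (1/(n−1)) R^m_m`. -/
noncomputable def Rsc (G : Fin n → Vec n → Vec n → ℝ) (x y : Vec n) : ℝ :=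
  (1 / ((n : ℝ) - 1)) * ∑ m, Riem2 G m m x y

/-- `Π := ∂G^m/∂y^m`. -/
noncomputable def PiG (G : Fin n → Vec n → Vec n → ℝ) (x y : Vec n) : ℝ :=
  ∑ m, Nc G m m x y

/-- The S-curvature of `(G, dV)` for the volume form `dV = σ(x) dx¹⋯dxⁿ`:
`S := Π − y^m ∂(ln σ)/∂x^m`. -/
noncomputable def Scurv (G : Fin n → Vec n → Vec n → ℝ) (σ : Vec n → ℝ)
    (x y : Vec n) : ℝ :=
  PiG G x y - ∑ m, y m * pd (fun x' => Real.log (σ x')) m x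

/-- The spray `Ĝ` associated with `(G, dV)`: `Ĝⁱ := Gⁱ − (S/(n+1)) yⁱ`. -/
noncomputable def Ghat (G : Fin n → Vec n → Vec n → ℝ) (σ : Vec n → ℝ)
    (i : Fin n) (x y : Vec n) : ℝ :=
  G i x y - (Scurv G σ x y / ((n : ℝ) + 1)) * y i

/-- `σ` is the (positive, smooth) density of a volume form `dV = σ(x) dx¹⋯dxⁿ` on `U`. -/
def IsVolumeForm (U : Set (Vec n)) (σ : Vec n → ℝ) : Prop :=
  ContDiffOn ℝ (⊤ : ℕ∞) σ U ∧ ∀ x ∈ U, 0 < σ x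

/-- `G` is of isotropic curvature on `U`: `Rⁱ_k = R δⁱ_k − (1/2) R_{·k} yⁱ`. -/
def IsIsotropicCurv (U : Set (Vec n)) (G : Fin n → Vec n → Vec n → ℝ) : Prop :=
  ∀ x ∈ U, ∀ y : Vec n, y ≠ 0 → ∀ i k,
    Riem2 G i k x y
      = Rsc G x y * (if i = k then 1 else 0) - (1 / 2) * pdy (Rsc G) k x y * y i

/-- `G` is of scalar curvature on `U`: `Rⁱ_k = R δⁱ_k − τ_k yⁱ` for some functions `τ_k`,
positively homogeneous of degree one in `y`, with `τ_k y^k = R`. -/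
def IsScalarCurv (U : Set (Vec n)) (G : Fin n → Vec n → Vec n → ℝ) : Prop :=
  ∃ τ : Fin n → Vec n → Vec n → ℝ,
    (∀ k (x y : Vec n) (lam : ℝ), 0 < lam → τ k x (lam • y) = lam * τ k x y) ∧
    ∀ x ∈ U, ∀ y : Vec n, y ≠ 0 →
      (∑ k, τ k x y * y k) = Rsc G x y ∧
      ∀ i k, Riem2 G i k x y
        = Rsc G x y * (if i = k then 1 else 0) - τ k x y * y i

/-- The slit domain `U × (ℝⁿ \ {0})`. -/
def slit (U : Set (Vec n)) : Set (Vec n × Vec n) := U ×ˢ {y : Vec n | y ≠ 0}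

/-- Smoothness on the slit domain. -/
def SlitSmooth (U : Set (Vec n)) (f : Vec n → Vec n → ℝ) : Prop :=
  ContDiffOn ℝ (⊤ : ℕ∞) (fun p : Vec n × Vec n => f p.1 p.2) (slit U)

/-- Positive homogeneity of degree `d` in `y`, on the slit domain. -/
def SlitHom (U : Set (Vec n)) (d : ℕ) (f : Vec n → Vec n → ℝ) : Prop :=
  ∀ x ∈ U, ∀ y : Vec n, y ≠ 0 → ∀ lam : ℝ, 0 < lam → f x (lam • y) = lam ^ d * f x y

theorem isOpen_slit {U : Set (Vec n)} (hU : IsOpen U) : IsOpen (slit U) :=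
  hU.prod isOpen_ne

theorem pdx_congr {U : Set (Vec n)} (hU : IsOpen U) {f g : Vec n → Vec n → ℝ}
    {x y : Vec n} (hx : x ∈ U) (h : ∀ x ∈ U, f x y = g x y) (k : Fin n) :
    pdx f k x y = pdx g k x y := by
  have : (fun x' => f x' y) =ᶠ[nhds x] fun x' => g x' y := by
    filter_upwards [hU.mem_nhds hx] with x' hx' using h x' hx'
  simp only [pdx, this.fderiv_eq]

theorem pdy_congr {f g : Vec n → Vec n → ℝ} {x y : Vec n} (hy : y ≠ 0)
    (h : ∀ y : Vec n, y ≠ 0 → f x y = g x y) (k : Fin n) :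
    pdy f k x y = pdy g k x y := by
  have : (fun y' => f x y') =ᶠ[nhds y] fun y' => g x y' := by
    filter_upwards [isOpen_ne.mem_nhds hy] with y' hy' using h y' hy'
  simp only [pdy, this.fderiv_eq]

namespace SlitSmooth

variable {U : Set (Vec n)} {f g : Vec n → Vec n → ℝ}

theorem congr (hf : SlitSmooth U f) (h : ∀ x ∈ U, ∀ y : Vec n, y ≠ 0 → g x y = f x y) :
    SlitSmooth U g :=
  ContDiffOn.congr hf fun p hp => h p.1 hp.1 p.2 hp.2

theorem add (hf : SlitSmooth U f) (hg : SlitSmooth U g) :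
    SlitSmooth U fun x y => f x y + g x y := ContDiffOn.add hf hg

theorem sub (hf : SlitSmooth U f) (hg : SlitSmooth U g) :
    SlitSmooth U fun x y => f x y - g x y := ContDiffOn.sub hf hg

theorem mul (hf : SlitSmooth U f) (hg : SlitSmooth U g) :
    SlitSmooth U fun x y => f x y * g x y := ContDiffOn.mul hf hg

theorem const (c : ℝ) : SlitSmooth U fun _ _ => c := contDiffOn_const

theorem coord (i : Fin n) : SlitSmooth U fun _ y => y i :=
  ContDiff.contDiffOn (by fun_prop)

theorem sum {ι : Type*} {s : Finset ι} {F : ι → Vec n → Vec n → ℝ}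
    (h : ∀ i ∈ s, SlitSmooth U (F i)) : SlitSmooth U fun x y => ∑ i ∈ s, F i x y :=
  ContDiffOn.sum (f := fun i (p : Vec n × Vec n) => F i p.1 p.2) h

theorem contDiffAt (hU : IsOpen U) (hf : SlitSmooth U f) {x y : Vec n} (hx : x ∈ U)
    (hy : y ≠ 0) : ContDiffAt ℝ (⊤ : ℕ∞) (fun p : Vec n × Vec n => f p.1 p.2) (x, y) :=
  ContDiffOn.contDiffAt hf ((isOpen_slit hU).mem_nhds (Set.mk_mem_prod hx hy))

theorem differentiableAt (hU : IsOpen U) (hf : SlitSmooth U f) {x y : Vec n} (hx : x ∈ U)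
    (hy : y ≠ 0) : DifferentiableAt ℝ (fun p : Vec n × Vec n => f p.1 p.2) (x, y) :=
  (hf.contDiffAt hU hx hy).differentiableAt (by simp)

theorem differentiableAt_fst (hU : IsOpen U) (hf : SlitSmooth U f) {x y : Vec n} (hx : x ∈ U)
    (hy : y ≠ 0) : DifferentiableAt ℝ (fun x' => f x' y) x :=
  DifferentiableAt.comp (f := fun x' => (x', y)) x (hf.differentiableAt hU hx hy) (by fun_prop)

theorem differentiableAt_snd (hU : IsOpen U) (hf : SlitSmooth U f) {x y : Vec n} (hx : x ∈ U)
    (hy : y ≠ 0) : DifferentiableAt ℝ (fun y' => f x y') y :=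
  DifferentiableAt.comp (f := fun y' => (x, y')) y (hf.differentiableAt hU hx hy) (by fun_prop)

theorem pdx_eq (hU : IsOpen U) (hf : SlitSmooth U f) {x y : Vec n} (hx : x ∈ U)
    (hy : y ≠ 0) (k : Fin n) : _root_.pdx f k x y =
      fderiv ℝ (fun p : Vec n × Vec n => f p.1 p.2) (x, y) (Pi.single k 1, 0) := by
  have h := (hf.differentiableAt hU hx hy).hasFDerivAt.comp (f := fun x' => (x', y)) x
    (hasFDerivAt_prodMk_left x y)
  have h' : fderiv ℝ (fun x' => f x' y) x = _ := h.fderiv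
  simp [_root_.pdx, h']

theorem pdy_eq (hU : IsOpen U) (hf : SlitSmooth U f) {x y : Vec n} (hx : x ∈ U)
    (hy : y ≠ 0) (k : Fin n) : _root_.pdy f k x y =
      fderiv ℝ (fun p : Vec n × Vec n => f p.1 p.2) (x, y) (0, Pi.single k 1) := by
  have h := (hf.differentiableAt hU hx hy).hasFDerivAt.comp (f := fun y' => (x, y')) y
    (hasFDerivAt_prodMk_right x y)
  have h' : fderiv ℝ (fun y' => f x y') y = _ := h.fderiv
  simp [_root_.pdy, h']

theorem fderiv_apply (hU : IsOpen U) (hf : SlitSmooth U f) (v : Vec n × Vec n) :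
    ContDiffOn ℝ (⊤ : ℕ∞)
      (fun p => fderiv ℝ (fun p : Vec n × Vec n => f p.1 p.2) p v) (slit U) :=
  (ContDiffOn.fderiv_of_isOpen hf (isOpen_slit hU) (by simp)).clm_apply contDiffOn_const

theorem pdx (hU : IsOpen U) (hf : SlitSmooth U f) (k : Fin n) :
    SlitSmooth U (_root_.pdx f k) :=
  (hf.fderiv_apply hU (Pi.single k 1, 0)).congr fun _ hp => hf.pdx_eq hU hp.1 hp.2 k

theorem pdy (hU : IsOpen U) (hf : SlitSmooth U f) (k : Fin n) :
    SlitSmooth U (_root_.pdy f k) :=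
  (hf.fderiv_apply hU (0, Pi.single k 1)).congr fun _ hp => hf.pdy_eq hU hp.1 hp.2 k

theorem pdy_comm (hU : IsOpen U) (hf : SlitSmooth U f) {x y : Vec n} (hx : x ∈ U)
    (hy : y ≠ 0) (j k : Fin n) :
    _root_.pdy (_root_.pdy f j) k x y = _root_.pdy (_root_.pdy f k) j x y := by
  have hc : ContDiffAt ℝ (⊤ : ℕ∞) (fun y' => f x y') y :=
    ContDiffAt.comp (f := fun y' => (x, y')) y (hf.contDiffAt hU hx hy) (by fun_prop)
  have hd : DifferentiableAt ℝ (fderiv ℝ fun y' => f x y') y :=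
    (hc.fderiv_right (m := 1) (by norm_cast)).differentiableAt (by simp)
  have hs : IsSymmSndFDerivAt ℝ (fun y' => f x y') y :=
    hc.isSymmSndFDerivAt (by
      rw [minSmoothness_of_isRCLikeNormedField]; exact WithTop.coe_le_coe.2 le_top)
  have key : ∀ a b : Fin n, _root_.pdy (_root_.pdy f a) b x y =
      fderiv ℝ (fderiv ℝ fun y' => f x y') y (Pi.single b 1) (Pi.single a 1) := by
    intro a b
    have := (hd.hasFDerivAt.clm_apply (hasFDerivAt_const (Pi.single a 1 : Vec n) y)).fderiv
    simp only [_root_.pdy, this]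
    simp
  rw [key, key, hs.eq]

end SlitSmooth

section Rules

variable {U : Set (Vec n)} {f g : Vec n → Vec n → ℝ} {x y : Vec n}

theorem pdx_coord_mul (c : Vec n → ℝ) (hU : IsOpen U) (hf : SlitSmooth U f) (hx : x ∈ U)
    (hy : y ≠ 0) (k : Fin n) :
    pdx (fun x y => c y * f x y) k x y = c y * pdx f k x y := by
  simp [pdx, fderiv_const_mul (hf.differentiableAt_fst hU hx hy)]

theorem pdx_add (hU : IsOpen U) (hf : SlitSmooth U f) (hg : SlitSmooth U g) (hx : x ∈ U)
    (hy : y ≠ 0) (k : Fin n) :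
    pdx (fun x y => f x y + g x y) k x y = pdx f k x y + pdx g k x y := by
  simp [pdx, fderiv_fun_add (hf.differentiableAt_fst hU hx hy)
    (hg.differentiableAt_fst hU hx hy)]

theorem pdx_sum {ι : Type*} {s : Finset ι} {F : ι → Vec n → Vec n → ℝ} (hU : IsOpen U)
    (hF : ∀ i ∈ s, SlitSmooth U (F i)) (hx : x ∈ U) (hy : y ≠ 0) (k : Fin n) :
    pdx (fun x y => ∑ i ∈ s, F i x y) k x y = ∑ i ∈ s, pdx (F i) k x y := by
  simp [pdx, fderiv_fun_sum fun i hi => (hF i hi).differentiableAt_fst hU hx hy]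

theorem pdy_coord (i k : Fin n) :
    pdy (fun _ y => y i) k x y = if i = k then 1 else 0 := by
  simp [pdy, fderiv_apply, Pi.single_apply]

theorem pdy_const_mul (c : ℝ) (hU : IsOpen U) (hf : SlitSmooth U f) (hx : x ∈ U)
    (hy : y ≠ 0) (k : Fin n) :
    pdy (fun x y => c * f x y) k x y = c * pdy f k x y := by
  simp [pdy, fderiv_const_mul (hf.differentiableAt_snd hU hx hy)]

theorem pdy_add (hU : IsOpen U) (hf : SlitSmooth U f) (hg : SlitSmooth U g) (hx : x ∈ U)
    (hy : y ≠ 0) (k : Fin n) :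
    pdy (fun x y => f x y + g x y) k x y = pdy f k x y + pdy g k x y := by
  simp [pdy, fderiv_fun_add (hf.differentiableAt_snd hU hx hy)
    (hg.differentiableAt_snd hU hx hy)]

theorem pdy_sub (hU : IsOpen U) (hf : SlitSmooth U f) (hg : SlitSmooth U g) (hx : x ∈ U)
    (hy : y ≠ 0) (k : Fin n) :
    pdy (fun x y => f x y - g x y) k x y = pdy f k x y - pdy g k x y := by
  simp [pdy, fderiv_fun_sub (hf.differentiableAt_snd hU hx hy)
    (hg.differentiableAt_snd hU hx hy)]

theorem pdy_mul (hU : IsOpen U) (hf : SlitSmooth U f) (hg : SlitSmooth U g) (hx : x ∈ U)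
    (hy : y ≠ 0) (k : Fin n) :
    pdy (fun x y => f x y * g x y) k x y = f x y * pdy g k x y + pdy f k x y * g x y := by
  simp [pdy, fderiv_fun_mul (hf.differentiableAt_snd hU hx hy)
    (hg.differentiableAt_snd hU hx hy), mul_comm]

theorem pdy_sum {ι : Type*} {s : Finset ι} {F : ι → Vec n → Vec n → ℝ} (hU : IsOpen U)
    (hF : ∀ i ∈ s, SlitSmooth U (F i)) (hx : x ∈ U) (hy : y ≠ 0) (k : Fin n) :
    pdy (fun x y => ∑ i ∈ s, F i x y) k x y = ∑ i ∈ s, pdy (F i) k x y := by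
  simp [pdy, fderiv_fun_sum fun i hi => (hF i hi).differentiableAt_snd hU hx hy]

end Rules

namespace SlitHom

variable {U : Set (Vec n)} {f : Vec n → Vec n → ℝ} {d : ℕ}

theorem pdx (hU : IsOpen U) (hs : SlitSmooth U f) (hf : SlitHom U d f) (k : Fin n) :
    SlitHom U d (_root_.pdx f k) := by
  intro x hx y hy lam hl
  have h1 : _root_.pdx f k x (lam • y) =
      _root_.pdx (fun x y => f x (lam • y)) k x y := rfl
  rw [h1, pdx_congr hU (g := fun x y => lam ^ d * f x y) hx
    (fun x hx => hf x hx y hy lam hl) k]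
  exact pdx_coord_mul (fun _ => lam ^ d) hU hs hx hy k

theorem pdy (hU : IsOpen U) (hs : SlitSmooth U f) (hf : SlitHom U (d + 1) f) (k : Fin n) :
    SlitHom U d (_root_.pdy f k) := by
  intro x hx y hy lam hl
  have h0 : lam • y ≠ 0 := smul_ne_zero hl.ne' hy
  have h1 := pdy_congr (f := fun x y => f x (lam • y)) (g := fun x y => lam ^ (d + 1) * f x y) hy
    (fun y hy => hf x hx y hy lam hl) k
  rw [pdy_const_mul _ hU hs hx hy] at h1
  have h2 := ((hs.differentiableAt_snd hU hx h0).hasFDerivAt.comp (f := fun y' => lam • y') y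
    ((hasFDerivAt_id y).const_smul lam))
  have h3 : fderiv ℝ (fun y' => f x (lam • y')) y = _ := h2.fderiv
  have h4 : _root_.pdy (fun x y => f x (lam • y)) k x y = lam * _root_.pdy f k x (lam • y) := by
    simp [_root_.pdy, h3]
  rw [h4] at h1
  apply mul_left_cancel₀ hl.ne'
  rw [h1]; ring

/-- Euler's identity. -/
theorem euler (hU : IsOpen U) (hs : SlitSmooth U f) (hf : SlitHom U d f) {x y : Vec n}
    (hx : x ∈ U) (hy : y ≠ 0) : ∑ k, y k * _root_.pdy f k x y = d * f x y := by
  have h0 : DifferentiableAt ℝ (fun y' => f x y') ((1 : ℝ) • y) := by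
    simpa using hs.differentiableAt_snd hU hx hy
  have h1 : HasDerivAt (fun t : ℝ => f x (t • y))
      (fderiv ℝ (fun y' => f x y') ((1 : ℝ) • y) ((1 : ℝ) • y)) 1 :=
    h0.hasFDerivAt.comp_hasDerivAt 1 ((hasDerivAt_id (1 : ℝ)).smul_const y)
  have h2 : HasDerivAt (fun t : ℝ => t ^ d * f x y) (d * f x y) 1 := by
    simpa using (hasDerivAt_pow d (1 : ℝ)).mul_const (f x y)
  have h3 : (fun t : ℝ => f x (t • y)) =ᶠ[nhds 1] fun t => t ^ d * f x y := by
    filter_upwards [isOpen_Ioi.mem_nhds (show (1 : ℝ) ∈ Set.Ioi 0 by simp)] with t ht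
      using hf x hx y hy t ht
  rw [(h2.congr_of_eventuallyEq h3).unique h1, one_smul]
  refine Eq.trans ?_ ((fderiv ℝ (fun y' => f x y') y).toLinearMap.pi_apply_eq_sum_univ y).symm
  refine Finset.sum_congr rfl fun k _ => ?_
  have : (fun j => if k = j then (1 : ℝ) else 0) = Pi.single k 1 := by
    ext j; simp [Pi.single_apply, eq_comm]
  rw [this]; rfl

end SlitHom

section Spray

variable {U : Set (Vec n)} {G : Fin n → Vec n → Vec n → ℝ} {x y : Vec n}

theorem IsSpray.smooth (hG : IsSpray U G) (i : Fin n) : SlitSmooth U (G i) := hG.1 i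

theorem IsSpray.hom (hG : IsSpray U G) (i : Fin n) : SlitHom U 2 (G i) :=
  fun x _ y _ lam hl => hG.2 i x y lam hl

theorem IsSpray.smooth_Nc (hU : IsOpen U) (hG : IsSpray U G) (i j : Fin n) :
    SlitSmooth U (Nc G i j) := (hG.smooth i).pdy hU j

theorem IsSpray.hom_Nc (hU : IsOpen U) (hG : IsSpray U G) (i j : Fin n) :
    SlitHom U 1 (Nc G i j) := (hG.hom i).pdy hU (hG.smooth i) j

theorem IsSpray.smooth_Ga (hU : IsOpen U) (hG : IsSpray U G) (i j k : Fin n) :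
    SlitSmooth U (Ga G i j k) := (hG.smooth_Nc hU i j).pdy hU k

theorem IsSpray.hom_Ga (hU : IsOpen U) (hG : IsSpray U G) (i j k : Fin n) :
    SlitHom U 0 (Ga G i j k) := (hG.hom_Nc hU i j).pdy hU (hG.smooth_Nc hU i j) k

theorem IsSpray.Ga_comm (hU : IsOpen U) (hG : IsSpray U G) (hx : x ∈ U) (hy : y ≠ 0)
    (i j k : Fin n) : Ga G i j k x y = Ga G i k j x y :=
  (hG.smooth i).pdy_comm hU hx hy j k

theorem IsSpray.sum_coord_mul_Nc (hU : IsOpen U) (hG : IsSpray U G) (hx : x ∈ U) (hy : y ≠ 0)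
    (i : Fin n) : ∑ l, y l * Nc G i l x y = 2 * G i x y :=
  mod_cast (hG.hom i).euler hU (hG.smooth i) hx hy

theorem IsSpray.sum_coord_mul_Ga (hU : IsOpen U) (hG : IsSpray U G) (hx : x ∈ U) (hy : y ≠ 0)
    (i l : Fin n) : ∑ j, y j * Ga G i j l x y = Nc G i l x y := by
  simp_rw [hG.Ga_comm hU hx hy i _ l]
  have h := (hG.hom_Nc hU i l).euler hU (hG.smooth_Nc hU i l) hx hy
  rwa [Nat.cast_one, one_mul] at h

theorem sum_coord_mul_pdx {F : Fin n → Vec n → Vec n → ℝ} {g : Vec n → Vec n → ℝ}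
    (hU : IsOpen U) (hF : ∀ j, SlitSmooth U (F j))
    (h : ∀ x ∈ U, ∀ y : Vec n, y ≠ 0 → ∑ j, y j * F j x y = g x y)
    (hx : x ∈ U) (hy : y ≠ 0) (k : Fin n) :
    ∑ j, y j * pdx (F j) k x y = pdx g k x y := by
  rw [← pdx_congr (f := fun x y => ∑ j, y j * F j x y) hU hx (fun x hx => h x hx y hy) k,
    pdx_sum hU (fun j _ => (SlitSmooth.coord j).mul (hF j)) hx hy]
  exact Finset.sum_congr rfl fun j _ => (pdx_coord_mul (fun y => y j) hU (hF j) hx hy k).symm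

theorem IsSpray.sum_coord_mul_pdy_Ga (hU : IsOpen U) (hG : IsSpray U G) (hx : x ∈ U)
    (hy : y ≠ 0) (i l m : Fin n) : ∑ j, y j * pdy (Ga G i j l) m x y = 0 := by
  have h := pdy_congr (f := fun x y => ∑ j, y j * Ga G i j l x y) hy
    (fun y hy => hG.sum_coord_mul_Ga hU hx hy i l) m
  rw [pdy_sum hU (fun j _ => (SlitSmooth.coord j).mul (hG.smooth_Ga hU i j l)) hx hy] at h
  simp_rw [fun j => pdy_mul hU (SlitSmooth.coord j) (hG.smooth_Ga hU i j l) hx hy m,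
    pdy_coord, Finset.sum_add_distrib] at h
  have h' : pdy (Nc G i l) m x y = Ga G i m l x y := hG.Ga_comm hU hx hy i l m
  rw [h'] at h
  simpa using h

/-- The Riemann curvature in terms of the spray coefficients and their derivatives. -/
theorem IsSpray.Riem2_eq (hU : IsOpen U) (hG : IsSpray U G) (hx : x ∈ U) (hy : y ≠ 0)
    (i k : Fin n) : Riem2 G i k x y =
      2 * pdx (G i) k x y - ∑ m, Nc G m k x y * Nc G i m x y
        - ∑ l, y l * pdx (Nc G i k) l x y + 2 * ∑ m, G m x y * Ga G i k m x y := by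
  have hpx : ∀ l k, ∑ j, y j * pdx (Ga G i j l) k x y = pdx (Nc G i l) k x y := fun l k =>
    sum_coord_mul_pdx hU (fun j => hG.smooth_Ga hU i j l)
      (fun x hx y hy => hG.sum_coord_mul_Ga hU hx hy i l) hx hy k
  have hhd : ∀ l k, ∑ j, y j * hd G (Ga G i j l) k x y = pdx (Nc G i l) k x y := by
    intro l k
    simp only [hd, mul_sub, Finset.sum_sub_distrib, hpx, Finset.mul_sum]
    rw [Finset.sum_comm]
    simp_rw [mul_left_comm (y _), ← Finset.mul_sum, hG.sum_coord_mul_pdy_Ga hU hx hy]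
    simp
  have h4 : ∀ l, ∑ j, y j * Riem4 G j i k l x y = pdx (Nc G i l) k x y - pdx (Nc G i k) l x y
      + ∑ s, (Ga G i k s x y * Nc G s l x y - Nc G s k x y * Ga G i l s x y) := by
    intro l
    simp only [Riem4, mul_add, mul_sub, Finset.sum_add_distrib, Finset.sum_sub_distrib, hhd,
      Finset.mul_sum]
    rw [Finset.sum_comm, Finset.sum_comm (f := fun j s => y j * (Ga G s j k x y * _))]
    simp_rw [← mul_assoc, ← Finset.sum_mul, hG.sum_coord_mul_Ga hU hx hy, mul_assoc,
      mul_left_comm (y _), ← Finset.mul_sum, hG.sum_coord_mul_Ga hU hx hy]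
  have h5 : ∑ l, y l * pdx (Nc G i l) k x y = 2 * pdx (G i) k x y := by
    rw [sum_coord_mul_pdx hU (fun j => hG.smooth_Nc hU i j)
      (fun x hx y hy => hG.sum_coord_mul_Nc hU hx hy i) hx hy k]
    exact pdx_coord_mul (fun _ => 2) hU (hG.smooth i) hx hy k
  have h6 : ∀ s, ∑ l, y l * Ga G i l s x y = Nc G i s x y :=
    hG.sum_coord_mul_Ga hU hx hy i
  have h7 : Riem2 G i k x y = ∑ l, y l * ∑ j, y j * Riem4 G j i k l x y := by
    rw [Riem2, Finset.sum_comm]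
    simp_rw [Finset.mul_sum]
    exact Finset.sum_congr rfl fun l _ => Finset.sum_congr rfl fun j _ => by ring
  rw [h7]
  simp_rw [h4, mul_add, mul_sub, Finset.sum_add_distrib, Finset.sum_sub_distrib, h5, mul_sub,
    Finset.sum_sub_distrib]
  simp_rw [Finset.mul_sum]
  rw [Finset.sum_comm (f := fun l s => y l * (Ga G i k s x y * _)),
    Finset.sum_comm (f := fun l s => y l * (Nc G s k x y * _))]
  simp_rw [mul_left_comm (y _), ← Finset.mul_sum, hG.sum_coord_mul_Nc hU hx hy, h6]
  rw [Finset.mul_sum, Finset.sum_congr rfl fun s _ => show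
    Ga G i k s x y * (2 * G s x y) = 2 * (G s x y * Ga G i k s x y) by ring]
  ring

theorem IsSpray.smooth_Riem2 (hU : IsOpen U) (hG : IsSpray U G) (i k : Fin n) :
    SlitSmooth U (Riem2 G i k) := by
  refine SlitSmooth.congr ?_ fun x hx y hy => hG.Riem2_eq hU hx hy i k
  exact ((((SlitSmooth.const 2).mul ((hG.smooth i).pdx hU k)).sub
    (.sum fun m _ => (hG.smooth_Nc hU m k).mul (hG.smooth_Nc hU i m))).sub
    (.sum fun l _ => (SlitSmooth.coord l).mul ((hG.smooth_Nc hU i k).pdx hU l))).add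
    ((SlitSmooth.const 2).mul (.sum fun m _ => (hG.smooth m).mul (hG.smooth_Ga hU i k m)))

theorem IsSpray.hom_Riem2 (hU : IsOpen U) (hG : IsSpray U G) (i k : Fin n) :
    SlitHom U 2 (Riem2 G i k) := by
  intro x hx y hy lam hl
  have hly : lam • y ≠ 0 := smul_ne_zero hl.ne' hy
  rw [hG.Riem2_eq hU hx hly, hG.Riem2_eq hU hx hy, (hG.hom i).pdx hU (hG.smooth i) k x hx y hy _ hl]
  simp_rw [fun a b => hG.hom_Nc hU a b x hx y hy _ hl, fun a => hG.hom a x hx y hy _ hl,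
    fun a b c => hG.hom_Ga hU a b c x hx y hy _ hl,
    fun l => (hG.hom_Nc hU i k).pdx hU (hG.smooth_Nc hU i k) l x hx y hy _ hl]
  simp only [mul_add, mul_sub, Finset.mul_sum, Pi.smul_apply, smul_eq_mul]
  congr 1; congr 1; congr 1
  · ring
  all_goals exact Finset.sum_congr rfl fun _ _ => by ring

theorem IsSpray.sum_Riem2_mul_coord (hU : IsOpen U) (hG : IsSpray U G) (hx : x ∈ U)
    (hy : y ≠ 0) (i : Fin n) : ∑ k, Riem2 G i k x y * y k = 0 := by
  have h1 : ∑ k, (∑ m, Nc G m k x y * Nc G i m x y) * y k =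
      2 * ∑ m, G m x y * Nc G i m x y := by
    simp_rw [Finset.sum_mul, Finset.mul_sum]
    rw [Finset.sum_comm]
    refine Finset.sum_congr rfl fun m _ => ?_
    rw [← mul_assoc, ← hG.sum_coord_mul_Nc hU hx hy m, Finset.sum_mul]
    exact Finset.sum_congr rfl fun _ _ => by ring
  have h2 : ∑ k, (∑ l, y l * pdx (Nc G i k) l x y) * y k = ∑ l, y l * (2 * pdx (G i) l x y) := by
    simp_rw [Finset.sum_mul]
    rw [Finset.sum_comm]
    refine Finset.sum_congr rfl fun l _ => ?_
    have h : pdx (fun x y => 2 * G i x y) l x y = 2 * pdx (G i) l x y :=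
      pdx_coord_mul (fun _ => 2) hU (hG.smooth i) hx hy l
    rw [← h, ← sum_coord_mul_pdx hU (fun j => hG.smooth_Nc hU i j)
      (fun x hx y hy => hG.sum_coord_mul_Nc hU hx hy i) hx hy l, Finset.mul_sum]
    exact Finset.sum_congr rfl fun _ _ => by ring
  have h3 : ∑ k, (∑ m, G m x y * Ga G i k m x y) * y k = ∑ m, G m x y * Nc G i m x y := by
    simp_rw [Finset.sum_mul]
    rw [Finset.sum_comm]
    refine Finset.sum_congr rfl fun m _ => ?_
    rw [← hG.sum_coord_mul_Ga hU hx hy i m, Finset.mul_sum]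
    exact Finset.sum_congr rfl fun _ _ => by ring
  simp_rw [hG.Riem2_eq hU hx hy, add_mul, sub_mul, Finset.sum_add_distrib,
    Finset.sum_sub_distrib, mul_assoc (2 : ℝ), ← Finset.mul_sum, h1, h2, h3, Finset.mul_sum]
  rw [Finset.sum_congr rfl fun l _ => show
    2 * (pdx (G i) l x y * y l) = y l * (2 * pdx (G i) l x y) by ring]
  ring

end Spray

section Projective

variable {U : Set (Vec n)} {G G₁ G₂ : Fin n → Vec n → Vec n → ℝ} {x y : Vec n}

/-- The trace-free part `R^i_k - R δ^i_k` of the Riemann curvature. -/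
def traceFree (G : Fin n → Vec n → Vec n → ℝ) (i k : Fin n) (x y : Vec n) : ℝ :=
  Riem2 G i k x y - Rsc G x y * (if i = k then 1 else 0)

/-- Under a projective change the Riemann curvature changes by a term `Ξ δ^i_k + τ_k y^i`. -/
theorem Riem2_projective_change (hU : IsOpen U) (hG₁ : IsSpray U G₁) (hG₂ : IsSpray U G₂)
    {P : Vec n → Vec n → ℝ} (hP : SlitSmooth U P) (hPh : SlitHom U 1 P)
    (hproj : ∀ i, ∀ x ∈ U, ∀ y : Vec n, y ≠ 0 → G₁ i x y = G₂ i x y + P x y * y i)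
    (hx : x ∈ U) (hy : y ≠ 0) :
    ∃ (Ξ : ℝ) (τ : Fin n → ℝ), ∀ i k, Riem2 G₁ i k x y =
      Riem2 G₂ i k x y + Ξ * (if i = k then 1 else 0) + τ k * y i := by
  have hPy : ∀ k, SlitSmooth U (pdy P k) := hP.pdy hU
  have hPi : ∀ i, SlitSmooth U fun x y => P x y * y i := fun i => hP.mul (.coord i)
  have hPki : ∀ k i, SlitSmooth U fun x y => pdy P k x y * y i := fun k i =>
    (hPy k).mul (.coord i)
  have hN : ∀ i k, ∀ x ∈ U, ∀ y : Vec n, y ≠ 0 → Nc G₁ i k x y =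
      Nc G₂ i k x y + (P x y * (if i = k then 1 else 0) + pdy P k x y * y i) := by
    intro i k x hx y hy
    have h := pdy_congr hy (g := fun x y => G₂ i x y + P x y * y i)
      (fun y hy => hproj i x hx y hy) k
    rw [pdy_add hU (hG₂.smooth i) (hPi i) hx hy, pdy_mul hU hP (.coord i) hx hy, pdy_coord] at h
    exact h
  have hΓ : ∀ i k m, Ga G₁ i k m x y = Ga G₂ i k m x y + (pdy P m x y * (if i = k then 1 else 0)
      + (pdy P k x y * (if i = m then 1 else 0) + pdy (pdy P k) m x y * y i)) := by
    intro i k m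
    have h := pdy_congr hy (g := fun x y => Nc G₂ i k x y +
      ((if i = k then 1 else 0) * P x y + pdy P k x y * y i))
      (fun y hy => by simpa only [mul_comm (P x y)] using hN i k x hx y hy) m
    have hPd : SlitSmooth U fun x y => (if i = k then 1 else 0) * P x y :=
      (SlitSmooth.const _).mul hP
    rw [pdy_add hU (hG₂.smooth_Nc hU i k) (hPd.add (hPki k i)) hx hy,
      pdy_add hU hPd (hPki k i) hx hy, pdy_const_mul _ hU hP hx hy,
      pdy_mul hU (hPy k) (.coord i) hx hy, pdy_coord] at h
    rw [Ga, h, Ga]; ring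
  have hGx : ∀ i k, pdx (G₁ i) k x y = pdx (G₂ i) k x y + y i * pdx P k x y := by
    intro i k
    have hc : SlitSmooth U fun x y => y i * P x y := (SlitSmooth.coord i).mul hP
    rw [pdx_congr hU hx (g := fun x y => G₂ i x y + y i * P x y)
      (fun x hx => by simpa only [mul_comm (P x y)] using hproj i x hx y hy) k,
      pdx_add hU (hG₂.smooth i) hc hx hy, pdx_coord_mul (fun y => y i) hU hP hx hy]
  have hNx : ∀ i k l, pdx (Nc G₁ i k) l x y = pdx (Nc G₂ i k) l x y +
      ((if i = k then 1 else 0) * pdx P l x y + y i * pdx (pdy P k) l x y) := by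
    intro i k l
    have hc : SlitSmooth U fun x y => y i * pdy P k x y := (SlitSmooth.coord i).mul (hPy k)
    have hd : SlitSmooth U fun x y => (if i = k then 1 else 0) * P x y :=
      (SlitSmooth.const _).mul hP
    rw [pdx_congr hU hx (g := fun x y => Nc G₂ i k x y +
        ((if i = k then 1 else 0) * P x y + y i * pdy P k x y))
      (fun x hx => by
        simpa only [mul_comm (P x y), mul_comm (pdy P k x y)] using hN i k x hx y hy) l,
      pdx_add hU (hG₂.smooth_Nc hU i k) (hd.add hc) hx hy, pdx_add hU hd hc hx hy,
      pdx_coord_mul (fun y => y i) hU (hPy k) hx hy,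
      pdx_coord_mul (fun _ => if i = k then 1 else 0) hU hP hx hy]
  have eP : ∑ m, y m * pdy P m x y = P x y := by
    have h := hPh.euler hU hP hx hy
    rwa [Nat.cast_one, one_mul] at h
  have ePk : ∀ k, ∑ m, y m * pdy (pdy P k) m x y = 0 := fun k => by
    simpa using (hPh.pdy (d := 0) hU hP k).euler hU (hPy k) hx hy
  have eN := hG₂.sum_coord_mul_Nc hU hx hy
  have eΓ : ∀ i k, ∑ m, y m * Ga G₂ i k m x y = Nc G₂ i k x y := fun i k => by
    simp_rw [hG₂.Ga_comm hU hx hy i k]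
    exact hG₂.sum_coord_mul_Ga hU hx hy i k
  refine ⟨P x y ^ 2 + 2 * ∑ m, G₂ m x y * pdy P m x y - ∑ l, y l * pdx P l x y,
    fun k => 2 * pdx P k x y - ∑ l, y l * pdx (pdy P k) l x y
      - ∑ m, Nc G₂ m k x y * pdy P m x y + 2 * ∑ m, G₂ m x y * pdy (pdy P k) m x y
      - P x y * pdy P k x y, fun i k => ?_⟩
  have hNN : ∑ m, Nc G₁ m k x y * Nc G₁ i m x y = ∑ m, Nc G₂ m k x y * Nc G₂ i m x y
      + 2 * P x y * Nc G₂ i k x y + (∑ m, Nc G₂ m k x y * pdy P m x y) * y i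
      + 2 * pdy P k x y * G₂ i x y + 3 * P x y * pdy P k x y * y i
      + P x y ^ 2 * (if i = k then 1 else 0) := by
    have h : ∀ m, Nc G₁ m k x y * Nc G₁ i m x y = Nc G₂ m k x y * Nc G₂ i m x y
        + P x y * (Nc G₂ m k x y * (if i = m then 1 else 0))
        + (Nc G₂ m k x y * pdy P m x y) * y i
        + P x y * (Nc G₂ i m x y * (if m = k then 1 else 0))
        + P x y ^ 2 * ((if i = m then 1 else 0) * (if m = k then 1 else 0))
        + P x y * y i * (pdy P m x y * (if m = k then 1 else 0))
        + pdy P k x y * (y m * Nc G₂ i m x y)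
        + P x y * pdy P k x y * (y m * (if i = m then 1 else 0))
        + pdy P k x y * y i * (y m * pdy P m x y) := by
      intro m
      rw [hN m k x hx y hy, hN i m x hx y hy]; ring
    simp_rw [h, Finset.sum_add_distrib, ← Finset.sum_mul, ← Finset.mul_sum, eN, eP]
    simp
    ring
  have hGΓ : ∑ m, G₁ m x y * Ga G₁ i k m x y = ∑ m, G₂ m x y * Ga G₂ i k m x y
      + (∑ m, G₂ m x y * pdy P m x y) * (if i = k then 1 else 0)
      + pdy P k x y * G₂ i x y + (∑ m, G₂ m x y * pdy (pdy P k) m x y) * y i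
      + P x y * Nc G₂ i k x y + P x y ^ 2 * (if i = k then 1 else 0)
      + P x y * pdy P k x y * y i := by
    have h : ∀ m, G₁ m x y * Ga G₁ i k m x y = G₂ m x y * Ga G₂ i k m x y
        + (G₂ m x y * pdy P m x y) * (if i = k then 1 else 0)
        + pdy P k x y * (G₂ m x y * (if i = m then 1 else 0))
        + (G₂ m x y * pdy (pdy P k) m x y) * y i
        + P x y * (y m * Ga G₂ i k m x y)
        + P x y * (if i = k then 1 else 0) * (y m * pdy P m x y)
        + P x y * pdy P k x y * (y m * (if i = m then 1 else 0))
        + P x y * y i * (y m * pdy (pdy P k) m x y) := by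
      intro m
      rw [hproj m x hx y hy, hΓ]; ring
    simp_rw [h, Finset.sum_add_distrib, ← Finset.sum_mul, ← Finset.mul_sum, eΓ, eP, ePk]
    simp only [mul_ite, mul_one, mul_zero, Finset.sum_ite_eq, Finset.mem_univ, if_true]
    split_ifs <;> ring
  have hyN : ∑ l, y l * pdx (Nc G₁ i k) l x y = ∑ l, y l * pdx (Nc G₂ i k) l x y
      + (∑ l, y l * pdx P l x y) * (if i = k then 1 else 0)
      + (∑ l, y l * pdx (pdy P k) l x y) * y i := by
    simp_rw [hNx, Finset.sum_mul, ← Finset.sum_add_distrib]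
    exact Finset.sum_congr rfl fun l _ => by ring
  rw [hG₁.Riem2_eq hU hx hy, hG₂.Riem2_eq hU hx hy, hNN, hGΓ, hyN, hGx]
  ring

theorem traceFree_projective_change (hn : 2 ≤ n) (hU : IsOpen U) (hG₁ : IsSpray U G₁)
    (hG₂ : IsSpray U G₂) {P : Vec n → Vec n → ℝ} (hP : SlitSmooth U P) (hPh : SlitHom U 1 P)
    (hproj : ∀ i, ∀ x ∈ U, ∀ y : Vec n, y ≠ 0 → G₁ i x y = G₂ i x y + P x y * y i)
    (hx : x ∈ U) (hy : y ≠ 0) :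
    ∃ τ : Fin n → ℝ, ∀ i k, traceFree G₁ i k x y = traceFree G₂ i k x y + τ k * y i := by
  obtain ⟨Ξ, τ, h⟩ := Riem2_projective_change hU hG₁ hG₂ hP hPh hproj hx hy
  have hn' : (n : ℝ) - 1 ≠ 0 := by
    have : (2 : ℝ) ≤ n := mod_cast hn
    linarith
  refine ⟨τ, fun i k => ?_⟩
  have hΞ : Ξ = -∑ k, τ k * y k := by
    obtain ⟨j, hj⟩ := Function.ne_iff.1 hy
    have h0 := hG₁.sum_Riem2_mul_coord hU hx hy j
    have h2 := hG₂.sum_Riem2_mul_coord hU hx hy j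
    have h3 : ∀ k, Riem2 G₁ j k x y * y k = Riem2 G₂ j k x y * y k
        + Ξ * (y k * (if j = k then 1 else 0)) + y j * (τ k * y k) := fun k => by
      rw [h]; ring
    simp_rw [h3, Finset.sum_add_distrib, ← Finset.mul_sum, h2] at h0
    have h4 : y j * (Ξ + ∑ k, τ k * y k) = 0 := by
      rw [← h0]
      simp only [mul_ite, mul_one, mul_zero, Finset.sum_ite_eq, Finset.mem_univ, if_true]
      ring
    have := (mul_eq_zero.1 h4).resolve_left hj
    linarith
  have hR : Rsc G₁ x y = Rsc G₂ x y + Ξ := by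
    simp_rw [Rsc, h, Finset.sum_add_distrib]
    rw [show ∑ k, τ k * y k = -Ξ by rw [hΞ, neg_neg]]
    simp
    field_simp
    ring
  rw [traceFree, traceFree, h, hR]
  ring

theorem IsSpray.smooth_Rsc (hU : IsOpen U) (hG : IsSpray U G) : SlitSmooth U (Rsc G) :=
  (SlitSmooth.const _).mul (.sum fun m _ => hG.smooth_Riem2 hU m m)

theorem IsSpray.hom_Rsc (hU : IsOpen U) (hG : IsSpray U G) : SlitHom U 2 (Rsc G) := by
  intro x hx y hy lam hl
  simp_rw [Rsc, fun m => hG.hom_Riem2 hU m m x hx y hy lam hl, ← Finset.mul_sum]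
  ring

theorem IsSpray.smooth_traceFree (hU : IsOpen U) (hG : IsSpray U G) (i k : Fin n) :
    SlitSmooth U (traceFree G i k) :=
  (hG.smooth_Riem2 hU i k).sub ((hG.smooth_Rsc hU).mul (.const _))

theorem IsSpray.hom_traceFree (hU : IsOpen U) (hG : IsSpray U G) (i k : Fin n) :
    SlitHom U 2 (traceFree G i k) := by
  intro x hx y hy lam hl
  rw [traceFree, traceFree, hG.hom_Riem2 hU i k x hx y hy lam hl,
    hG.hom_Rsc hU x hx y hy lam hl]
  ring

/-- If `χ = 0`, the divergence of the trace-free Riemann curvature is `-(n+1)/2 R_{·k}`. -/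
theorem IsSpray.sum_pdy_traceFree (hn : 2 ≤ n) (hU : IsOpen U) (hG : IsSpray U G)
    (hx : x ∈ U) (hy : y ≠ 0) (k : Fin n) (hchi : chi G k x y = 0) :
    ∑ m, pdy (traceFree G m k) m x y = -((n + 1) / 2) * pdy (Rsc G) k x y := by
  have hn' : (n : ℝ) - 1 ≠ 0 := by
    have : (2 : ℝ) ≤ n := mod_cast hn
    linarith
  have h1 : ∀ m, pdy (traceFree G m k) m x y =
      pdy (Riem2 G m k) m x y - (if m = k then 1 else 0) * pdy (Rsc G) m x y := by
    intro m
    have hR := hG.smooth_Rsc hU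
    rw [← pdy_const_mul _ hU hR hx hy, ← pdy_sub hU (hG.smooth_Riem2 hU m k)
      ((SlitSmooth.const _).mul hR) hx hy]
    exact pdy_congr hy (fun y _ => by rw [traceFree, mul_comm]) m
  have h2 : ∑ m, pdy (Riem2 G m m) k x y = (n - 1) * pdy (Rsc G) k x y := by
    have hS : SlitSmooth U fun x y => ∑ m, Riem2 G m m x y := .sum fun m _ =>
      hG.smooth_Riem2 hU m m
    have h := pdy_const_mul (1 / ((n : ℝ) - 1)) hU hS hx hy k
    rw [pdy_sum hU (fun m _ => hG.smooth_Riem2 hU m m) hx hy] at h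
    rw [show pdy (Rsc G) k x y = _ from h]
    field_simp
  rw [chi, h2] at hchi
  simp_rw [h1, Finset.sum_sub_distrib]
  simp
  linarith

theorem IsSpray.isIsotropicCurv_iff (hn : 2 ≤ n) (hU : IsOpen U) (hG : IsSpray U G)
    (hchi : ∀ x ∈ U, ∀ y : Vec n, y ≠ 0 → ∀ k, chi G k x y = 0) :
    IsIsotropicCurv U G ↔ ∀ x ∈ U, ∀ y : Vec n, y ≠ 0 → ∀ i k m,
      y m * traceFree G i k x y = y i * traceFree G m k x y := by
  refine ⟨fun h x hx y hy i k m => ?_, fun h x hx y hy i k => ?_⟩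
  · rw [traceFree, traceFree, h x hx y hy, h x hx y hy]
    ring
  · have hB := hG.smooth_traceFree hU
    have h1 : ∀ m, y m * pdy (traceFree G i k) m x y + traceFree G i k x y =
        y i * pdy (traceFree G m k) m x y + (if i = m then 1 else 0) * traceFree G m k x y := by
      intro m
      have := pdy_congr (f := fun x y => y m * traceFree G i k x y)
        (g := fun x y => y i * traceFree G m k x y) hy (fun y hy => h x hx y hy i k m) m
      rw [pdy_mul hU (.coord m) (hB i k) hx hy, pdy_mul hU (.coord i) (hB m k) hx hy,
        pdy_coord, pdy_coord] at this
      simpa using this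
    have h2 := Finset.sum_congr (rfl : (Finset.univ : Finset (Fin n)) = _) fun m _ => h1 m
    simp_rw [Finset.sum_add_distrib, ← Finset.mul_sum,
      hG.sum_pdy_traceFree hn hU hx hy k (hchi x hx y hy k),
      (hG.hom_traceFree hU i k).euler hU (hB i k) hx hy] at h2
    simp at h2
    have h3 : ((n : ℝ) + 1) * (traceFree G i k x y + 1 / 2 * pdy (Rsc G) k x y * y i) = 0 := by
      linear_combination h2
    have h4 := (mul_eq_zero.1 h3).resolve_left (by positivity)
    rw [traceFree] at h4
    linarith

end Projective

/-- Beltrami theorem for sprays with `χ = 0`. -/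
theorem beltrami_for_sprays_with_chi_zero
    {n : ℕ} (hn : 2 ≤ n) (U : Set (Vec n)) (hU : IsOpen U)
    (G₁ G₂ : Fin n → Vec n → Vec n → ℝ) (hG₁ : IsSpray U G₁) (hG₂ : IsSpray U G₂)
    (P : Vec n → Vec n → ℝ)
    (hPsm : ContDiffOn ℝ (⊤ : ℕ∞) (fun p : Vec n × Vec n => P p.1 p.2)
      (U ×ˢ {y : Vec n | y ≠ 0}))
    (hPhom : ∀ (x y : Vec n) (lam : ℝ), 0 < lam → P x (lam • y) = lam * P x y)
    (hproj : ∀ i, ∀ x ∈ U, ∀ y : Vec n, y ≠ 0 → G₁ i x y = G₂ i x y + P x y * y i)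
    (hchi₁ : ∀ x ∈ U, ∀ y : Vec n, y ≠ 0 → ∀ k, chi G₁ k x y = 0)
    (hchi₂ : ∀ x ∈ U, ∀ y : Vec n, y ≠ 0 → ∀ k, chi G₂ k x y = 0) :
    IsIsotropicCurv U G₁ ↔ IsIsotropicCurv U G₂ := by
  have hPh : SlitHom U 1 P := fun x _ y _ lam hl => by rw [hPhom x y lam hl, pow_one]
  rw [hG₁.isIsotropicCurv_iff hn hU hchi₁, hG₂.isIsotropicCurv_iff hn hU hchi₂]
  refine forall₄_congr fun x hx y hy => forall₃_congr fun i k m => ?_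
  obtain ⟨τ, h⟩ := traceFree_projective_change hn hU hG₁ hG₂ hPsm hPh hproj hx hy
  rw [h, h]
  constructor <;> intro h' <;> linear_combination h'
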